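/- Let u : ℝⁿ → ℝ, n ≥ 2, be a smooth function with |Du(x)| < 1 for all x ∈ ℝⁿ, and suppose there is a constant c ∈ ℝ such that div(Du/√(1+|Du|²)) = c and div(Du/√(1−|Du|²)) = c on all of ℝⁿ (the entire graph of u has the same constant mean curvature functions H_R and H_L). Then c = 0 and the graph of u is a spacelike hyperplane: u is an affine function u(x) = ⟨a, x⟩ + b with |a| < 1. -/

import Mathlib

open scoped RealInnerProductSpace

/-- Divergence of a vector field on ℝⁿ. -/
noncomputable def vdiv {n : ℕ} (X : EuclideanSpace ℝ (Fin n) → EuclideanSpace ℝ (Fin n))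
    (x : EuclideanSpace ℝ (Fin n)) : ℝ :=
  ∑ i, ⟪fderiv ℝ X x (EuclideanSpace.single i 1), EuclideanSpace.single i 1⟫

/-- Hessian bilinear form `D²u(x)(v,w)` of a function on ℝⁿ. -/
noncomputable def hess {n : ℕ} (u : EuclideanSpace ℝ (Fin n) → ℝ)
    (x v w : EuclideanSpace ℝ (Fin n)) : ℝ :=
  ⟪fderiv ℝ (gradient u) x v, w⟫

/-- The Lorentz–Minkowski inner product on ℝⁿ × ℝ = 𝕃^{n+1}. -/
noncomputable def linner {n : ℕ} (p q : EuclideanSpace ℝ (Fin n) × ℝ) : ℝ :=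
  ⟪p.1, q.1⟫ - p.2 * q.2

section Divergence

open MeasureTheory

variable {n : ℕ}

theorem HasFDerivAt.vdiv_eq {X : EuclideanSpace ℝ (Fin n) → EuclideanSpace ℝ (Fin n)}
    {X' : EuclideanSpace ℝ (Fin n) →L[ℝ] EuclideanSpace ℝ (Fin n)}
    {x : EuclideanSpace ℝ (Fin n)} (h : HasFDerivAt X X' x) :
    vdiv X x = ∑ i, X' (EuclideanSpace.single i 1) i := by
  simp [vdiv, h.fderiv, EuclideanSpace.inner_single_right]

theorem ContinuousLinearMap.sum_apply_single_mul
    (L : EuclideanSpace ℝ (Fin n) →L[ℝ] ℝ) (v : EuclideanSpace ℝ (Fin n)) :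
    ∑ i, L (EuclideanSpace.single i 1) * v i = L v := by
  conv_rhs => rw [← (EuclideanSpace.basisFun (Fin n) ℝ).sum_repr v]
  simp [mul_comm]

theorem vdiv_smul {f : EuclideanSpace ℝ (Fin n) → ℝ}
    {X : EuclideanSpace ℝ (Fin n) → EuclideanSpace ℝ (Fin n)}
    {f' : EuclideanSpace ℝ (Fin n) →L[ℝ] ℝ} {x : EuclideanSpace ℝ (Fin n)}
    (hf : HasFDerivAt f f' x) (hX : DifferentiableAt ℝ X x) :
    vdiv (fun y => f y • X y) x = f x * vdiv X x + f' (X x) := by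
  rw [(hf.fun_smul hX.hasFDerivAt).vdiv_eq, hX.hasFDerivAt.vdiv_eq,
    ← f'.sum_apply_single_mul (X x), Finset.mul_sum, ← Finset.sum_add_distrib]
  simp

theorem vdiv_sub {X Y : EuclideanSpace ℝ (Fin n) → EuclideanSpace ℝ (Fin n)}
    {x : EuclideanSpace ℝ (Fin n)} (hX : DifferentiableAt ℝ X x) (hY : DifferentiableAt ℝ Y x) :
    vdiv (fun y => X y - Y y) x = vdiv X x - vdiv Y x := by
  rw [(hX.hasFDerivAt.fun_sub hY.hasFDerivAt).vdiv_eq, hX.hasFDerivAt.vdiv_eq,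
    hY.hasFDerivAt.vdiv_eq, ← Finset.sum_sub_distrib]
  simp

theorem vdiv_comp_add_smul {X : EuclideanSpace ℝ (Fin n) → EuclideanSpace ℝ (Fin n)}
    (hX : Differentiable ℝ X) (a : EuclideanSpace ℝ (Fin n)) (r : ℝ)
    (x : EuclideanSpace ℝ (Fin n)) :
    vdiv (fun y => X (a + r • y)) x = r * vdiv X (a + r • x) := by
  have h₁ : HasFDerivAt (fun y : EuclideanSpace ℝ (Fin n) => a + r • y)
      (r • ContinuousLinearMap.id ℝ (EuclideanSpace ℝ (Fin n))) x :=
    ((hasFDerivAt_id x).const_smul r).const_add a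
  have h₂ := (hX (a + r • x)).hasFDerivAt
  have h₃ : HasFDerivAt (fun y => X (a + r • y)) _ x := h₂.comp x h₁
  rw [h₃.vdiv_eq, h₂.vdiv_eq, Finset.mul_sum]
  simp

theorem vdiv_comp_add_right (X : EuclideanSpace ℝ (Fin n) → EuclideanSpace ℝ (Fin n))
    (a x : EuclideanSpace ℝ (Fin n)) :
    vdiv (fun y => X (y + a)) x = vdiv X (x + a) := by
  simp [vdiv, fderiv_comp_add_right]

theorem continuous_vdiv {X : EuclideanSpace ℝ (Fin n) → EuclideanSpace ℝ (Fin n)}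
    (hX : ContDiff ℝ 1 X) : Continuous (vdiv X) := by
  have := hX.continuous_fderiv one_ne_zero
  unfold vdiv
  fun_prop

/-- The divergence theorem against a compactly supported test function. -/
theorem integral_mul_vdiv {ψ : EuclideanSpace ℝ (Fin n) → ℝ}
    {X : EuclideanSpace ℝ (Fin n) → EuclideanSpace ℝ (Fin n)}
    (hψ : ContDiff ℝ 1 ψ) (hψc : HasCompactSupport ψ) (hX : ContDiff ℝ 1 X) :
    ∫ y, ψ y * vdiv X y = -∫ y, fderiv ℝ ψ y (X y) := by
  have hXi (i : Fin n) : ContDiff ℝ 1 (fun y => X y i) := by fun_prop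
  have hdψ := hψ.continuous_fderiv one_ne_zero
  have hdX (i : Fin n) := (hXi i).continuous_fderiv one_ne_zero
  have hX0 := hX.continuous
  have hψ0 := hψ.continuous
  have hdψc := hψc.fderiv (𝕜 := ℝ)
  have int₁ (i : Fin n) : Integrable
      (fun y => ψ y * fderiv ℝ (fun z => X z i) y (EuclideanSpace.single i 1)) := by
    have := hdX i
    exact Continuous.integrable_of_hasCompactSupport (by fun_prop) hψc.mul_right
  have int₂ (i : Fin n) : Integrable
      (fun y => fderiv ℝ ψ y (EuclideanSpace.single i 1) * X y i) := by
    refine Continuous.integrable_of_hasCompactSupport (by fun_prop) ?_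
    exact (hdψc.comp_left (g := fun L : EuclideanSpace ℝ (Fin n) →L[ℝ] ℝ =>
      L (EuclideanSpace.single i 1)) (by simp)).mul_right
  have int₃ (i : Fin n) : Integrable (fun y => ψ y * X y i) :=
    Continuous.integrable_of_hasCompactSupport (by fun_prop) hψc.mul_right
  have hdiv (y : EuclideanSpace ℝ (Fin n)) : vdiv X y =
      ∑ i, fderiv ℝ (fun z => X z i) y (EuclideanSpace.single i 1) := by
    have hy := (hX.differentiable one_ne_zero y).hasFDerivAt
    rw [hy.vdiv_eq]
    refine Finset.sum_congr rfl fun i _ => ?_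
    have h := ((EuclideanSpace.proj (𝕜 := ℝ) i).hasFDerivAt (x := X y)).comp y hy
    have h' : HasFDerivAt (fun z => X z i)
        ((EuclideanSpace.proj (𝕜 := ℝ) i).comp (fderiv ℝ X y)) y := h
    rw [h'.fderiv]
    simp
  calc ∫ y, ψ y * vdiv X y
      = ∑ i, ∫ y, ψ y * fderiv ℝ (fun z => X z i) y (EuclideanSpace.single i 1) := by
        simp_rw [hdiv, Finset.mul_sum]
        exact integral_finsetSum _ fun i _ => int₁ i
    _ = ∑ i, -∫ y, fderiv ℝ ψ y (EuclideanSpace.single i 1) * X y i :=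
        Finset.sum_congr rfl fun i _ =>
          integral_mul_fderiv_eq_neg_fderiv_mul_of_integrable (int₂ i) (int₁ i) (int₃ i)
            (fun y _ => hψ.differentiable one_ne_zero y)
            (fun y _ => (hXi i).differentiable one_ne_zero y)
    _ = -∫ y, fderiv ℝ ψ y (X y) := by
        rw [Finset.sum_neg_distrib, ← integral_finsetSum _ fun i _ => int₂ i]
        simp_rw [ContinuousLinearMap.sum_apply_single_mul]

end Divergence

section QuadraticBump

open MeasureTheory Metric Set Topology

variable {n : ℕ}

/-- The truncated paraboloid `max 0 (1 - ‖y‖²)`. -/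
noncomputable def quadraticBump (y : EuclideanSpace ℝ (Fin n)) : ℝ := max 0 (1 - ‖y‖ ^ 2)

theorem continuous_quadraticBump : Continuous (quadraticBump (n := n)) := by
  unfold quadraticBump
  fun_prop

theorem quadraticBump_nonneg (y : EuclideanSpace ℝ (Fin n)) : 0 ≤ quadraticBump y :=
  le_max_left _ _

theorem quadraticBump_zero : quadraticBump (0 : EuclideanSpace ℝ (Fin n)) = 1 := by
  simp [quadraticBump]

theorem quadraticBump_eq_zero {y : EuclideanSpace ℝ (Fin n)} (hy : 1 ≤ ‖y‖) :
    quadraticBump y = 0 :=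
  max_eq_left (by nlinarith)

theorem quadraticBump_of_notMem {y : EuclideanSpace ℝ (Fin n)}
    (hy : y ∉ closedBall (0 : EuclideanSpace ℝ (Fin n)) 1) : quadraticBump y = 0 :=
  quadraticBump_eq_zero (by simpa using (not_le.1 (by simpa using hy)).le)

theorem hasCompactSupport_quadraticBump : HasCompactSupport (quadraticBump (n := n)) :=
  HasCompactSupport.intro (isCompact_closedBall 0 1) fun _ hy => quadraticBump_of_notMem hy

theorem integral_quadraticBump_pos :
    0 < ∫ y : EuclideanSpace ℝ (Fin n), quadraticBump y :=
  continuous_quadraticBump.integral_pos_of_hasCompactSupport_nonneg_nonzero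
    hasCompactSupport_quadraticBump quadraticBump_nonneg (x := 0) (by simp [quadraticBump_zero])

theorem hasCompactSupport_quadraticBump_sq :
    HasCompactSupport (fun y : EuclideanSpace ℝ (Fin n) => quadraticBump y ^ 2) :=
  hasCompactSupport_quadraticBump.comp_left (g := fun t : ℝ => t ^ 2) (by simp)

theorem integral_quadraticBump_sq_pos :
    0 < ∫ y : EuclideanSpace ℝ (Fin n), quadraticBump y ^ 2 :=
  (continuous_quadraticBump.pow 2).integral_pos_of_hasCompactSupport_nonneg_nonzero
    hasCompactSupport_quadraticBump_sq (fun _ => sq_nonneg _) (x := 0)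
    (by simp [quadraticBump_zero])

theorem hasDerivAt_max_zero_sq (t : ℝ) :
    HasDerivAt (fun s : ℝ => max 0 s ^ 2) (2 * max 0 t) t := by
  rcases lt_trichotomy t 0 with ht | rfl | ht
  · rw [max_eq_left ht.le, mul_zero]
    refine (hasDerivAt_const t (0 : ℝ)).congr_of_eventuallyEq ?_
    filter_upwards [Iio_mem_nhds ht] with s hs
    simp [max_eq_left (mem_Iio.1 hs).le]
  · rw [hasDerivAt_iff_isLittleO_nhds_zero]
    have h : (fun s : ℝ => max 0 s ^ 2) =O[𝓝 0] fun s : ℝ => s ^ 2 := by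
      refine Asymptotics.isBigO_of_le _ fun s => ?_
      rw [norm_pow, norm_pow]
      gcongr
      rcases le_total 0 s with hs | hs <;> simp [hs]
    have h' : (fun s : ℝ => s ^ 2) =o[𝓝 0] fun s : ℝ => s := by
      simpa using Asymptotics.isLittleO_pow_pow (𝕜 := ℝ) one_lt_two
    simpa using h.trans_isLittleO h'
  · rw [max_eq_right ht.le]
    have h : HasDerivAt (fun s : ℝ => s ^ 2) (2 * t) t := by
      simpa using hasDerivAt_pow 2 t
    refine h.congr_of_eventuallyEq ?_
    filter_upwards [Ioi_mem_nhds ht] with s hs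
    simp [max_eq_right (mem_Ioi.1 hs).le]

theorem hasFDerivAt_quadraticBump_sq (y : EuclideanSpace ℝ (Fin n)) :
    HasFDerivAt (fun z : EuclideanSpace ℝ (Fin n) => quadraticBump z ^ 2)
      ((-4 * quadraticBump y) • innerSL ℝ y) y := by
  have h := ((hasFDerivAt_id y).norm_sq).const_sub 1
  have h' := (hasDerivAt_max_zero_sq (1 - ‖y‖ ^ 2)).comp_hasFDerivAt y h
  refine HasFDerivAt.congr_fderiv h' ?_
  ext v
  simp [quadraticBump]
  ring

theorem contDiff_quadraticBump_sq :
    ContDiff ℝ 1 (fun z : EuclideanSpace ℝ (Fin n) => quadraticBump z ^ 2) := by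
  refine contDiff_one_iff_hasFDerivAt.2 ⟨_, ?_, hasFDerivAt_quadraticBump_sq⟩
  have := continuous_quadraticBump (n := n)
  fun_prop

theorem integral_quadraticBump_sq_mul_vdiv
    {X : EuclideanSpace ℝ (Fin n) → EuclideanSpace ℝ (Fin n)} (hX : ContDiff ℝ 1 X) :
    ∫ y, quadraticBump y ^ 2 * vdiv X y = 4 * ∫ y, quadraticBump y * ⟪X y, y⟫ := by
  rw [integral_mul_vdiv contDiff_quadraticBump_sq hasCompactSupport_quadraticBump_sq hX,
    ← integral_const_mul, ← integral_neg]
  congr 1 with y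
  rw [(hasFDerivAt_quadraticBump_sq y).fderiv]
  simp [real_inner_comm]
  ring

theorem abs_quadraticBump_sub_sub_le {y z : EuclideanSpace ℝ (Fin n)} (hz : ‖z‖ ≤ 1)
    (hy : ‖y‖ ≤ 2) : |quadraticBump (y - z) - quadraticBump y| ≤ 5 * ‖z‖ := by
  have h₁ : |quadraticBump (y - z) - quadraticBump y| ≤ |‖y‖ ^ 2 - ‖y - z‖ ^ 2| := by
    have h := abs_max_sub_max_le_abs (1 - ‖y - z‖ ^ 2) (1 - ‖y‖ ^ 2) 0
    rwa [max_comm _ 0, max_comm _ 0, sub_sub_sub_cancel_left] at h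
  have h₂ : |‖y‖ - ‖y - z‖| ≤ ‖z‖ := by simpa using abs_norm_sub_norm_le y (y - z)
  have h₃ : ‖y - z‖ ≤ 3 := (norm_sub_le y z).trans (by linarith)
  have h₄ : |‖y‖ + ‖y - z‖| ≤ 5 := by
    rw [abs_of_nonneg (by positivity)]
    linarith
  calc _ ≤ _ := h₁
    _ = |‖y‖ + ‖y - z‖| * |‖y‖ - ‖y - z‖| := by rw [← abs_mul]; ring_nf
    _ ≤ 5 * ‖z‖ := by gcongr

end QuadraticBump

section Liouville

open MeasureTheory Metric Set Filter Topology

variable {n : ℕ}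

/-- A bounded vector field with constant divergence is divergence free. -/
theorem eq_zero_of_vdiv_eq_const {X : EuclideanSpace ℝ (Fin n) → EuclideanSpace ℝ (Fin n)}
    {c M : ℝ} (hX : ContDiff ℝ 1 X) (hM : ∀ x, ‖X x‖ ≤ M) (hc : ∀ x, vdiv X x = c) : c = 0 := by
  have hM0 : 0 ≤ M := (norm_nonneg _).trans (hM 0)
  set K := M * ∫ y : EuclideanSpace ℝ (Fin n), quadraticBump y with hK
  set I := ∫ y : EuclideanSpace ℝ (Fin n), quadraticBump y ^ 2
  have hIpos : 0 < I := integral_quadraticBump_sq_pos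
  have key (r : ℝ) : |r * c * I| ≤ 4 * K := by
    have h := integral_quadraticBump_sq_mul_vdiv
      (X := fun y => X (0 + r • y)) (hX.comp (by fun_prop))
    simp_rw [vdiv_comp_add_smul (hX.differentiable one_ne_zero), hc, integral_mul_const] at h
    rw [mul_comm, h, abs_mul, abs_of_pos (by norm_num : (0 : ℝ) < 4), hK, ← integral_const_mul,
      ← Real.norm_eq_abs]
    gcongr
    refine norm_integral_le_of_norm_le
      ((continuous_quadraticBump.integrable_of_hasCompactSupport
        hasCompactSupport_quadraticBump).const_mul M) (ae_of_all _ fun y => ?_)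
    rw [norm_mul, Real.norm_of_nonneg (quadraticBump_nonneg y), mul_comm]
    rcases le_total 1 ‖y‖ with hy | hy
    · simp [quadraticBump_eq_zero hy]
    · gcongr
      · exact quadraticBump_nonneg y
      · calc ‖⟪X (0 + r • y), y⟫‖ ≤ ‖X (0 + r • y)‖ * ‖y‖ := norm_inner_le_norm _ _
          _ ≤ M * 1 := by gcongr; exact hM _
          _ = M := mul_one M
  by_contra hc0
  have h := key ((4 * K + 1) / (c * I))
  have h' : (4 * K + 1) / (c * I) * c * I = 4 * K + 1 := by
    field_simp
  rw [h'] at h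
  linarith [le_abs_self (4 * K + 1)]

theorem contDiff_gradient {f : EuclideanSpace ℝ (Fin n) → ℝ} {k m : WithTop ℕ∞}
    (hf : ContDiff ℝ m f) (hk : k + 1 ≤ m) : ContDiff ℝ k (gradient f) :=
  (InnerProductSpace.toDual ℝ (EuclideanSpace ℝ (Fin n))).symm.contDiff.comp (hf.fderiv_right hk)

/-- Mean value property of harmonic functions, with the weight `quadraticBump`. -/
theorem integral_comp_add_smul_mul_quadraticBump {w : EuclideanSpace ℝ (Fin n) → ℝ}
    (hw : ContDiff ℝ 2 w) (hharm : ∀ x, vdiv (gradient w) x = 0)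
    (x : EuclideanSpace ℝ (Fin n)) (r : ℝ) :
    ∫ y, w (x + r • y) * quadraticBump y =
      w x * ∫ y : EuclideanSpace ℝ (Fin n), quadraticBump y := by
  have hw0 := hw.continuous
  have hw1 := hw.continuous_fderiv two_ne_zero
  have hb := continuous_quadraticBump (n := n)
  have hbc := hasCompactSupport_quadraticBump (n := n)
  have hG : ContDiff ℝ 1 (gradient w) := contDiff_gradient hw (by norm_num)
  have hderiv (r : ℝ) :
      HasDerivAt (fun r : ℝ => ∫ y, w (x + r • y) * quadraticBump y) 0 r := by
    have hzero : ∫ y, fderiv ℝ w (x + r • y) y * quadraticBump y = 0 := by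
      have h := integral_quadraticBump_sq_mul_vdiv
        (X := fun y => gradient w (x + r • y)) (hG.comp (by fun_prop))
      simp_rw [vdiv_comp_add_smul (hG.differentiable one_ne_zero), hharm,
        inner_gradient_left] at h
      simp_rw [mul_comm _ (quadraticBump _)]
      simpa using h.symm
    obtain ⟨C, hC⟩ := ((isCompact_closedBall r 1).prod
      (isCompact_closedBall (0 : EuclideanSpace ℝ (Fin n)) 1)).exists_bound_of_continuousOn
      (f := fun p : ℝ × EuclideanSpace ℝ (Fin n) => fderiv ℝ w (x + p.1 • p.2) p.2)
      (by fun_prop)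
    have h := (hasDerivAt_integral_of_dominated_loc_of_deriv_le (μ := volume)
      (F := fun (r : ℝ) y => w (x + r • y) * quadraticBump y)
      (F' := fun (r : ℝ) y => fderiv ℝ w (x + r • y) y * quadraticBump y)
      (bound := fun y => C * quadraticBump y)
      (ball_mem_nhds r one_pos)
      (Eventually.of_forall fun s => Continuous.aestronglyMeasurable (by fun_prop))
      (Continuous.integrable_of_hasCompactSupport (by fun_prop) hbc.mul_left)
      (Continuous.aestronglyMeasurable (by fun_prop))
      (ae_of_all _ fun y s hs => ?_)
      ((hb.integrable_of_hasCompactSupport hbc).const_mul C)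
      (ae_of_all _ fun y s _ => ?_)).2
    · rwa [hzero] at h
    · rw [norm_mul, Real.norm_of_nonneg (quadraticBump_nonneg y)]
      by_cases hy : y ∈ closedBall (0 : EuclideanSpace ℝ (Fin n)) 1
      · exact mul_le_mul_of_nonneg_right (hC (s, y) ⟨ball_subset_closedBall hs, hy⟩)
          (quadraticBump_nonneg y)
      · simp [quadraticBump_of_notMem hy]
    · have h₁ : HasDerivAt (fun s : ℝ => x + s • y) y s := by
        simpa using ((hasDerivAt_id s).smul_const y).const_add x
      exact ((hw.differentiable two_ne_zero _).hasFDerivAt.comp_hasDerivAt s h₁).mul_const _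
  have hconst := is_const_of_deriv_eq_zero (fun r => (hderiv r).differentiableAt)
    (fun r => (hderiv r).deriv) r 0
  rw [hconst]
  simp [integral_const_mul]

/-- **Liouville's theorem**: bounded harmonic functions on `ℝⁿ` are constant. -/
theorem eq_of_harmonic_of_bounded {w : EuclideanSpace ℝ (Fin n) → ℝ} {M : ℝ}
    (hw : ContDiff ℝ 2 w) (hharm : ∀ x, vdiv (gradient w) x = 0) (hM : ∀ x, |w x| ≤ M)
    (x : EuclideanSpace ℝ (Fin n)) : w x = w 0 := by
  have hw0 := hw.continuous
  have hb := continuous_quadraticBump (n := n)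
  have hbc := hasCompactSupport_quadraticBump (n := n)
  have hM0 : 0 ≤ M := (abs_nonneg _).trans (hM 0)
  set I := ∫ y : EuclideanSpace ℝ (Fin n), quadraticBump y
  have hIpos : 0 < I := integral_quadraticBump_pos
  set V := volume.real (closedBall (0 : EuclideanSpace ℝ (Fin n)) 2)
  have key (t : ℝ) (ht : 0 < t) (htx : ‖t • x‖ ≤ 1) :
      |(w x - w 0) * I| ≤ M * (5 * ‖t • x‖) * V := by
    have h₁ : ∫ y, w (t⁻¹ • y) * quadraticBump (y - t • x) = w x * I := by
      rw [← integral_comp_add_smul_mul_quadraticBump hw hharm x t⁻¹,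
        ← integral_add_right_eq_self _ (t • x)]
      congr 1 with y
      rw [add_sub_cancel_right, smul_add, inv_smul_smul₀ ht.ne', add_comm]
    have h₂ := integral_comp_add_smul_mul_quadraticBump hw hharm 0 t⁻¹
    simp_rw [zero_add] at h₂
    have hshift : HasCompactSupport (fun y => quadraticBump (y - t • x)) := by
      simpa [sub_eq_add_neg, Function.comp_def] using
        hbc.comp_homeomorph (Homeomorph.addRight (-(t • x)))
    have int₁ : Integrable (fun y => w (t⁻¹ • y) * quadraticBump (y - t • x)) :=
      Continuous.integrable_of_hasCompactSupport (by fun_prop) hshift.mul_left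
    have int₂ : Integrable (fun y => w (t⁻¹ • y) * quadraticBump y) :=
      Continuous.integrable_of_hasCompactSupport (by fun_prop) hbc.mul_left
    rw [sub_mul, ← h₁, ← h₂, ← integral_sub int₁ int₂,
      ← setIntegral_eq_integral_of_forall_compl_eq_zero
        (s := closedBall (0 : EuclideanSpace ℝ (Fin n)) 2), ← Real.norm_eq_abs]
    · refine norm_setIntegral_le_of_norm_le_const measure_closedBall_lt_top fun y hy => ?_
      rw [← mul_sub, norm_mul]
      exact mul_le_mul (hM _) (abs_quadraticBump_sub_sub_le htx (by simpa using hy))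
        (norm_nonneg _) hM0
    · intro y hy
      have hy' : 2 < ‖y‖ := by simpa using hy
      have := norm_sub_norm_le y (t • x)
      rw [quadraticBump_eq_zero (y := y) (by linarith),
        quadraticBump_eq_zero (y := y - t • x) (by linarith), sub_self]
  have hlim : Tendsto (fun t : ℝ => M * (5 * ‖t • x‖) * V) (𝓝[>] 0) (𝓝 0) := by
    have h : Continuous (fun t : ℝ => M * (5 * ‖t • x‖) * V) := by fun_prop
    simpa using (h.tendsto 0).mono_left nhdsWithin_le_nhds
  have hsmall : ∀ᶠ t : ℝ in 𝓝[>] 0, ‖t • x‖ ≤ 1 := by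
    have h : Continuous (fun t : ℝ => ‖t • x‖) := by fun_prop
    refine nhdsWithin_le_nhds ((h.tendsto 0).eventually (Iic_mem_nhds ?_))
    simp
  have hle : |(w x - w 0) * I| ≤ 0 := by
    refine ge_of_tendsto hlim ?_
    filter_upwards [hsmall, self_mem_nhdsWithin] with t h₁ h₂ using key t h₂ h₁
  have := abs_nonpos_iff.1 hle
  rcases mul_eq_zero.1 this with h | h
  · linarith
  · exact absurd h hIpos.ne'

/-- A harmonic function with bounded gradient is affine. -/
theorem exists_eq_inner_add_of_harmonic {u : EuclideanSpace ℝ (Fin n) → ℝ} {M : ℝ}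
    (hu : ContDiff ℝ 2 u) (hharm : ∀ x, vdiv (gradient u) x = 0)
    (hM : ∀ x, ‖gradient u x‖ ≤ M) :
    ∃ (a : EuclideanSpace ℝ (Fin n)) (b : ℝ), ∀ x, u x = ⟪a, x⟫ + b := by
  have hG : Differentiable ℝ (gradient u) :=
    (contDiff_gradient (k := 1) hu (by norm_num)).differentiable one_ne_zero
  have hdiff := hu.differentiable two_ne_zero
  have hlip (x y : EuclideanSpace ℝ (Fin n)) : |u y - u x| ≤ M * ‖y - x‖ := by
    rw [← Real.norm_eq_abs]
    refine convex_univ.norm_image_sub_le_of_norm_fderiv_le (𝕜 := ℝ) (fun z _ => hdiff z)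
      (fun z _ => ?_) (mem_univ x) (mem_univ y)
    rw [← toDual_gradient, LinearIsometryEquiv.norm_map]
    exact hM z
  have hadd (x h : EuclideanSpace ℝ (Fin n)) : u (x + h) - u x = u h - u 0 := by
    have hgrad : gradient (fun y => u (y + h) - u y) =
        fun y => gradient u (y + h) - gradient u y := by
      refine gradient_eq fun y => ?_
      rw [hasGradientAt_iff_hasFDerivAt, map_sub, toDual_gradient, toDual_gradient]
      exact ((hasFDerivAt_comp_add_right h).2 (hdiff (y + h)).hasFDerivAt).sub
        (hdiff y).hasFDerivAt
    have := eq_of_harmonic_of_bounded (w := fun y => u (y + h) - u y) (M := M * ‖h‖)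
      (by fun_prop) (fun y => ?_) (fun y => by simpa using hlip y (y + h)) x
    · simpa using this
    · have hG' : Differentiable ℝ (fun y => gradient u (y + h)) :=
        hG.comp (differentiable_id.add_const h)
      rw [hgrad, vdiv_sub (hG' y) (hG y), vdiv_comp_add_right, hharm, hharm, sub_zero]
  let A : EuclideanSpace ℝ (Fin n) →+ ℝ :=
    { toFun := fun x => u x - u 0
      map_zero' := sub_self _
      map_add' := fun x y => by linarith [hadd x y] }
  let L := A.toRealLinearMap (hu.continuous.sub continuous_const)
  refine ⟨(InnerProductSpace.toDual ℝ _).symm L, u 0, fun x => ?_⟩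
  rw [InnerProductSpace.toDual_symm_apply]
  change u x = u x - u 0 + u 0
  ring

end Liouville

section MeanCurvature

variable {n : ℕ}

theorem hasFDerivAt_inv_sqrt_one_add_mul_norm_sq
    {G : EuclideanSpace ℝ (Fin n) → EuclideanSpace ℝ (Fin n)} {ε : ℝ}
    {x : EuclideanSpace ℝ (Fin n)} (hG : DifferentiableAt ℝ G x) (h : 0 < 1 + ε * ‖G x‖ ^ 2) :
    HasFDerivAt (fun y => (Real.sqrt (1 + ε * ‖G y‖ ^ 2))⁻¹)
      (-(ε * (Real.sqrt (1 + ε * ‖G x‖ ^ 2))⁻¹ ^ 3) • innerSL ℝ (G x) ∘SL fderiv ℝ G x) x := by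
  have h₁ := (hG.hasFDerivAt.norm_sq.const_mul ε).const_add 1
  have hs : 0 < Real.sqrt (1 + ε * ‖G x‖ ^ 2) := Real.sqrt_pos.2 h
  have h₂ := (((hasDerivAt_id _).sqrt h.ne').inv hs.ne').comp_hasFDerivAt x h₁
  refine HasFDerivAt.congr_fderiv h₂ ?_
  ext v
  simp
  field_simp

theorem vdiv_inv_sqrt_smul {G : EuclideanSpace ℝ (Fin n) → EuclideanSpace ℝ (Fin n)} {ε : ℝ}
    {x : EuclideanSpace ℝ (Fin n)} (hG : DifferentiableAt ℝ G x) (h : 0 < 1 + ε * ‖G x‖ ^ 2) :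
    vdiv (fun y => (Real.sqrt (1 + ε * ‖G y‖ ^ 2))⁻¹ • G y) x =
      (Real.sqrt (1 + ε * ‖G x‖ ^ 2))⁻¹ ^ 3 *
        ((1 + ε * ‖G x‖ ^ 2) * vdiv G x - ε * ⟪G x, fderiv ℝ G x (G x)⟫) := by
  rw [vdiv_smul (hasFDerivAt_inv_sqrt_one_add_mul_norm_sq hG h) hG]
  have hs : 0 < Real.sqrt (1 + ε * ‖G x‖ ^ 2) := Real.sqrt_pos.2 h
  have hsq := Real.sq_sqrt h.le
  set s := Real.sqrt (1 + ε * ‖G x‖ ^ 2)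
  rw [← hsq]
  simp
  field_simp
  ring

end MeanCurvature

/-- An entire spacelike graph with the same constant mean curvature functions
in ℝ^{n+1} and 𝕃^{n+1} is a spacelike hyperplane, and the constant is zero. -/
theorem entire_cmc_is_hyperplane {n : ℕ} (hn : 2 ≤ n)
    (u : EuclideanSpace ℝ (Fin n) → ℝ) (hu : ContDiff ℝ (⊤ : ℕ∞) u)
    (hsp : ∀ x, ‖gradient u x‖ < 1) (c : ℝ)
    (hR : ∀ x,
      vdiv (fun y => (Real.sqrt (1 + ‖gradient u y‖ ^ 2))⁻¹ • gradient u y) x = c)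
    (hL : ∀ x,
      vdiv (fun y => (Real.sqrt (1 - ‖gradient u y‖ ^ 2))⁻¹ • gradient u y) x = c) :
    c = 0 ∧ ∃ (a : EuclideanSpace ℝ (Fin n)) (b : ℝ), ‖a‖ < 1 ∧
      ∀ x, u x = ⟪a, x⟫ + b := by
  have hu2 : ContDiff ℝ 2 u := contDiff_infty.1 hu 2
  have hG : ContDiff ℝ 1 (gradient u) := contDiff_gradient hu2 (by norm_num)
  have hdG := hG.differentiable one_ne_zero
  have hpos (x) : 0 < 1 + (1 : ℝ) * ‖gradient u x‖ ^ 2 := by positivity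
  have hneg (x) : 0 < 1 + (-1 : ℝ) * ‖gradient u x‖ ^ 2 := by
    nlinarith [hsp x, norm_nonneg (gradient u x)]
  have hc : c = 0 := by
    refine eq_zero_of_vdiv_eq_const (M := 1) ?_ (fun x => ?_) hR
    · refine ContDiff.smul (ContDiff.inv (ContDiff.sqrt ?_ fun x => ?_) fun x => ?_) hG
      · exact contDiff_const.add (hG.norm_sq ℝ)
      · positivity
      · positivity
    · rw [norm_smul, norm_inv, Real.norm_of_nonneg (Real.sqrt_nonneg _)]
      have h₁ : 1 ≤ Real.sqrt (1 + ‖gradient u x‖ ^ 2) :=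
        Real.one_le_sqrt.2 (by linarith [sq_nonneg ‖gradient u x‖])
      exact mul_le_one₀ (inv_le_one_of_one_le₀ h₁) (norm_nonneg _) (hsp x).le
  refine ⟨hc, ?_⟩
  have hharm (x) : vdiv (gradient u) x = 0 := by
    have h₁ := vdiv_inv_sqrt_smul (hdG x) (hpos x)
    have h₂ := vdiv_inv_sqrt_smul (hdG x) (hneg x)
    simp only [one_mul] at h₁
    simp only [neg_one_mul, ← sub_eq_add_neg] at h₂
    rw [hR x, hc] at h₁
    rw [hL x, hc] at h₂
    have hp := hpos x
    have hn := hneg x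
    rw [one_mul] at hp
    rw [neg_one_mul, ← sub_eq_add_neg] at hn
    have e₁ := (mul_eq_zero.1 h₁.symm).resolve_left (by positivity)
    have e₂ := (mul_eq_zero.1 h₂.symm).resolve_left (by positivity)
    linarith
  obtain ⟨a, b, hab⟩ := exists_eq_inner_add_of_harmonic hu2 hharm
    fun x => (hsp x).le
  refine ⟨a, b, ?_, hab⟩
  have hga : gradient u 0 = a := by
    refine HasGradientAt.gradient ?_
    rw [hasGradientAt_iff_hasFDerivAt, funext hab]
    exact ((InnerProductSpace.toDual ℝ _ a).hasFDerivAt).add_const b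
  exact hga ▸ hsp 0
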